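/- Let X be a Banach space, Y a normed space, F : X ⇉ Y a closed set-valued map, (x̄,ȳ) ∈ gph F and (u,v) ∈ X×Y. Then the following are equivalent: (i) liminf |∇φ(·,y)|(x) > 0, where the liminf is taken over (x,y) →_{(u,v)} (x̄,ȳ) with φ(x,y) > 0 and φ(x,y)/‖(x,y) − (x̄,ȳ)‖ → 0; (ii) there exist reals τ > 0 and δ > 0 such that d(x, F⁻¹(y)) ≤ τ d(y, F(x)) for all (x,y) ∈ B((x̄,ȳ), δ) ∩ ((x̄,ȳ) + cone B((u,v), δ)) with d(y, F(x)) ≤ δ ‖(x,y) − (x̄,ȳ)‖; that is, F is directionally metrically regular at (x̄,ȳ) in direction (u,v) with modulus τ. -/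

import Mathlib

open Filter Metric Set Topology
open scoped ENNReal NNReal Classical

noncomputable section

/-- The conic hull `⋃ λ ≥ 0, λ • B((u,v), ε)` of the open ball of radius `ε` around `(u, v)`
in `X × Y`, where `X × Y` carries the sum norm `‖(x,y)‖ = ‖x‖ + ‖y‖`. -/
def coneBall2 {X Y : Type*} [NormedAddCommGroup X] [NormedSpace ℝ X]
    [NormedAddCommGroup Y] [NormedSpace ℝ Y] (u : X) (v : Y) (ε : ℝ) : Set (X × Y) :=
  {p | ∃ lam : ℝ, 0 ≤ lam ∧ ∃ w : X, ∃ z : Y, ‖w - u‖ + ‖z - v‖ < ε ∧ p = (lam • w, lam • z)}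

/-- `F` is directionally metrically `γ`-regular at `(xbar, ybar)` in direction `(u, v)`
with modulus `τ`: there are `δ, ε, η > 0` such that `d(x, F⁻¹(y)) ≤ τ d(y, F(x))^γ`
for all `(x,y) ∈ B((xbar,ybar), δ)` with `(x,y) ∈ (xbar,ybar) + cone B((u,v), ε)` and
`d(y,F(x)) ≤ η ‖(x,y)-(xbar,ybar)‖^(1/γ)`.  Distances to sets are extended-real valued
(equal to `+∞` for the empty set). -/
def DirHolderRegular {X Y : Type*} [NormedAddCommGroup X] [NormedSpace ℝ X]
    [NormedAddCommGroup Y] [NormedSpace ℝ Y]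
    (F : X → Set Y) (xbar : X) (ybar : Y) (u : X) (v : Y) (γ τ : ℝ) : Prop :=
  ∃ δ > (0:ℝ), ∃ ε > (0:ℝ), ∃ η > (0:ℝ), ∀ x : X, ∀ y : Y,
    ‖x - xbar‖ + ‖y - ybar‖ < δ →
    (x - xbar, y - ybar) ∈ coneBall2 u v ε →
    EMetric.infEdist y (F x) ≤ ENNReal.ofReal (η * (‖x - xbar‖ + ‖y - ybar‖) ^ (1/γ)) →
    EMetric.infEdist x {x' : X | y ∈ F x'} ≤ ENNReal.ofReal τ * EMetric.infEdist y (F x) ^ γ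

/-- The lower semicontinuous envelope `φ(x,y) = liminf_{x' → x} d(y, F(x'))`. -/
def lscEnv {X Y : Type*} [NormedAddCommGroup X] [NormedSpace ℝ X] [NormedAddCommGroup Y]
    (F : X → Set Y) (x : X) (y : Y) : ℝ≥0∞ :=
  Filter.liminf (fun x' : X => EMetric.infEdist y (F x')) (𝓝 x)

/-- The nonlocal slope `|Γf|(x)`: equal to `+∞` if `f x = +∞`, to `0` if `x` is a local
minimum of `f`, and otherwise to `sup_{z ≠ x} [f(x) − f(z)]₊ / d(x,z)` (the positive part
being realized by the truncated subtraction of `ℝ≥0∞`). -/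
def nonlocalSlope {X : Type*} [PseudoEMetricSpace X] (f : X → ℝ≥0∞) (x : X) : ℝ≥0∞ :=
  if f x = ⊤ then ⊤
  else if ∀ᶠ z in 𝓝 x, f x ≤ f z then 0
  else ⨆ z : {z : X // z ≠ x}, (f x - f (z : X)) / edist x (z : X)

/-- The local slope `|∇f|(x)`: equal to `+∞` if `f x = +∞`, to `0` if `x` is a local
minimum of `f`, and otherwise to `limsup_{z → x, z ≠ x} (f(x) − f(z)) / d(x,z)`. -/
def localSlope {X : Type*} [PseudoEMetricSpace X] (f : X → ℝ≥0∞) (x : X) : ℝ≥0∞ :=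
  if f x = ⊤ then ⊤
  else if ∀ᶠ z in 𝓝 x, f x ≤ f z then 0
  else Filter.limsup (fun z : X => (f x - f z) / edist x z) (𝓝[≠] x)

/-- The filter of directional convergence `(x,y) →_{(u,v)} (xbar,ybar)`:
convergence to `(xbar,ybar)` together with eventual membership of `(x,y) − (xbar,ybar)`
in every conic neighborhood `cone B((u,v), δ)`, `δ > 0`, of the direction `(u,v)`. -/
def dirFilter {X Y : Type*} [NormedAddCommGroup X] [NormedSpace ℝ X]
    [NormedAddCommGroup Y] [NormedSpace ℝ Y] (xbar : X) (ybar : Y) (u : X) (v : Y) :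
    Filter (X × Y) :=
  𝓝 (xbar, ybar) ⊓
    ⨅ (δ : ℝ) (_ : 0 < δ), 𝓟 {p : X × Y | (p.1 - xbar, p.2 - ybar) ∈ coneBall2 u v δ}

/-- The filter encoding the constrained directional convergence
`(x,y) →_{(u,v)} (xbar,ybar)`, `φ(x,y) > 0`, `φ(x,y)^γ/‖(x,y) − (xbar,ybar)‖ → 0`. -/
def dirRegFilter {X Y : Type*} [NormedAddCommGroup X] [NormedSpace ℝ X]
    [NormedAddCommGroup Y] [NormedSpace ℝ Y]
    (F : X → Set Y) (xbar : X) (ybar : Y) (u : X) (v : Y) (γ : ℝ) : Filter (X × Y) :=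
  dirFilter xbar ybar u v ⊓ 𝓟 {p : X × Y | 0 < lscEnv F p.1 p.2} ⊓
    ⨅ (η : ℝ) (_ : 0 < η),
      𝓟 {p : X × Y |
        lscEnv F p.1 p.2 ^ γ < ENNReal.ofReal (η * (‖p.1 - xbar‖ + ‖p.2 - ybar‖))}

/-- **Ekeland's variational principle** for extended nonnegative functions: a lower
semicontinuous function which is finite at `x₀` has a point below `x₀` that strictly minimizes
the perturbed function `w ↦ f w + c * edist w z`. -/
theorem LowerSemicontinuous.exists_forall_lt_add_mul_edist {α : Type*} [EMetricSpace α]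
    [CompleteSpace α] {f : α → ℝ≥0∞} (hf : LowerSemicontinuous f) {c : ℝ≥0∞} (hc : c ≠ 0)
    (hc' : c ≠ ⊤) {x₀ : α} (hx₀ : f x₀ ≠ ⊤) :
    ∃ z, f z + c * edist z x₀ ≤ f x₀ ∧ ∀ w, w ≠ z → f z < f w + c * edist w z := by
  set S : α → Set α := fun w => {z | f z + c * edist z w ≤ f w} with hS
  have S_self : ∀ w, w ∈ S w := fun w => by simp [hS]
  have S_trans : ∀ {a b d}, a ∈ S b → b ∈ S d → a ∈ S d := by
    intro a b d hab hbd
    calc f a + c * edist a d ≤ f a + c * (edist a b + edist b d) := by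
          gcongr; exact edist_triangle _ _ _
      _ = (f a + c * edist a b) + c * edist b d := by ring
      _ ≤ f b + c * edist b d := by gcongr; exact hab
      _ ≤ f d := hbd
  have S_closed : ∀ w, IsClosed (S w) := by
    intro w
    refine LowerSemicontinuous.isClosed_preimage (LowerSemicontinuous.add hf ?_) (f w)
    exact ((ENNReal.continuous_const_mul hc').comp
      (continuous_id.edist continuous_const)).lowerSemicontinuous
  have key : ∀ (n : ℕ) (w : α), ∃ z ∈ S w, ∀ z' ∈ S w, f z ≤ f z' + (n : ℝ≥0∞)⁻¹ := by
    intro n w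
    by_cases hI : (⨅ z ∈ S w, f z) = ⊤
    · refine ⟨w, S_self w, fun z' hz' => ?_⟩
      simp only [iInf_eq_top] at hI
      simp [hI z' hz']
    · have : (⨅ z ∈ S w, f z) < (⨅ z ∈ S w, f z) + (n : ℝ≥0∞)⁻¹ :=
        ENNReal.lt_add_right hI (by simp)
      obtain ⟨z, hz⟩ := iInf_lt_iff.1 this
      obtain ⟨hzS, hz⟩ := iInf_lt_iff.1 hz
      refine ⟨z, hzS, fun z' hz' => hz.le.trans ?_⟩
      gcongr
      exact iInf₂_le z' hz'
  choose g gS gle using key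
  set x : ℕ → α := fun n => Nat.rec x₀ g n with hx
  have x_succ : ∀ n, x (n + 1) = g n (x n) := fun n => rfl
  have x_mem : ∀ n k, x (n + k) ∈ S (x n) := by
    intro n k
    induction k with
    | zero => exact S_self _
    | succ k ih => exact S_trans (gS _ _) ih
  have x_ne_top : ∀ n, f (x n) ≠ ⊤ := by
    intro n
    have h := x_mem 0 n
    rw [zero_add] at h
    exact ne_top_of_le_ne_top hx₀ (le_self_add.trans h)
  have small : ∀ n, ∀ z ∈ S (x (n + 1)), c * edist z (x (n + 1)) ≤ (n : ℝ≥0∞)⁻¹ := by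
    intro n z hz
    have h1 : f (x (n + 1)) ≤ f z + (n : ℝ≥0∞)⁻¹ := gle n (x n) z (S_trans hz (x_mem n 1))
    have hz' : f z + c * edist z (x (n + 1)) ≤ f (x (n + 1)) := hz
    have hfz : f z ≠ ⊤ := ne_top_of_le_ne_top (x_ne_top (n + 1)) (le_self_add.trans hz')
    exact (ENNReal.add_le_add_iff_left hfz).1 (hz'.trans h1)
  have small' : ∀ ε : ℝ≥0∞, 0 < ε → ∃ n, ∀ z ∈ S (x n), edist z (x n) < ε := by
    intro ε hε
    obtain ⟨n, hn⟩ := ENNReal.exists_inv_nat_lt (mul_ne_zero hc hε.ne')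
    exact ⟨n + 1, fun z hz => lt_of_mul_lt_mul_left' ((small n z hz).trans_lt hn)⟩
  have hcauchy : CauchySeq x := by
    refine EMetric.cauchySeq_iff'.2 fun ε hε => ?_
    obtain ⟨N, hN⟩ := small' ε hε
    refine ⟨N, fun n hn => ?_⟩
    obtain ⟨k, rfl⟩ := Nat.exists_eq_add_of_le hn
    exact hN _ (x_mem N k)
  obtain ⟨z, hz⟩ := cauchySeq_tendsto_of_complete hcauchy
  have z_mem : ∀ n, z ∈ S (x n) := by
    intro n
    refine (S_closed _).mem_of_tendsto hz ?_
    filter_upwards [eventually_ge_atTop n] with k hk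
    obtain ⟨j, rfl⟩ := Nat.exists_eq_add_of_le hk
    exact x_mem n j
  refine ⟨z, z_mem 0, fun w hwz => ?_⟩
  by_contra! hw
  refine hwz (edist_le_zero.1 (le_of_forall_gt fun ε hε => ?_))
  obtain ⟨n, hn⟩ := small' (ε / 2) (ENNReal.half_pos hε.ne')
  calc edist w z ≤ edist w (x n) + edist z (x n) := edist_triangle_right _ _ _
    _ < ε / 2 + ε / 2 := ENNReal.add_lt_add (hn _ (S_trans hw (z_mem n))) (hn _ (z_mem n))
    _ = ε := ENNReal.add_halves ε

section Slope

variable {X : Type*} [PseudoEMetricSpace X] {f : X → ℝ≥0∞} {x : X}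

/-- A global Lipschitz-type minorant of `f` through `x` bounds the local slope. -/
theorem localSlope_le_of_forall_le_add {c : ℝ≥0∞} (hx : f x ≠ ⊤)
    (h : ∀ w, f x ≤ f w + c * edist w x) : localSlope f x ≤ c := by
  unfold localSlope
  rw [if_neg hx]
  split_ifs
  · exact zero_le
  · refine limsup_le_of_le (by isBoundedDefault) (Eventually.of_forall fun w => ?_)
    refine ENNReal.div_le_of_le_mul (tsub_le_iff_left.2 ?_)
    rw [edist_comm x w]
    exact h w

/-- If `f` decreases by at least `t * a / 2` within distance `K * t * a` of `x` for every small
`t > 0`, then the local slope of `f` at `x` is at least `1 / (2 * K)`. -/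
theorem le_localSlope_of_forall_exists {a K : ℝ} (ha : 0 < a) (hK : 0 < K)
    (hx : f x = ENNReal.ofReal a)
    (h : ∀ t : ℝ, 0 < t → t < 1 → ∃ z, edist x z ≤ ENNReal.ofReal (K * (t * a)) ∧
      f z ≤ ENNReal.ofReal ((1 - t / 2) * a)) :
    ENNReal.ofReal (1 / (2 * K)) ≤ localSlope f x := by
  have hsmall : ∀ ε : ℝ≥0∞, 0 < ε →
      ∃ z, edist z x < ε ∧ f z < f x ∧ ENNReal.ofReal (1 / (2 * K)) ≤ (f x - f z) / edist x z := by
    intro ε hε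
    obtain ⟨r, hr, hrε⟩ := ENNReal.lt_iff_exists_nnreal_btwn.1 hε
    have hr0 : (0 : ℝ) < r := by exact_mod_cast hr
    obtain ⟨t, ht0, ht⟩ := exists_between (show (0 : ℝ) < min 1 (r / (K * a)) by positivity)
    have ht1 : t < 1 := ht.trans_le (min_le_left _ _)
    have htr : t * (K * a) < r := (lt_div_iff₀ (by positivity)).1 (ht.trans_le (min_le_right _ _))
    obtain ⟨z, hz, hfz⟩ := h t ht0 ht1
    have hta : 0 < t * a := by positivity
    refine ⟨z, ?_, ?_, ?_⟩
    · rw [edist_comm]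
      refine hz.trans_lt (lt_of_le_of_lt ?_ hrε)
      rw [← ENNReal.ofReal_coe_nnreal]
      exact ENNReal.ofReal_le_ofReal (by linarith)
    · rw [hx]
      exact hfz.trans_lt ((ENNReal.ofReal_lt_ofReal_iff ha).2 (by linarith))
    · have h1 : ENNReal.ofReal (t * a / 2) ≤ f x - f z := by
        refine le_trans ?_ (tsub_le_tsub_left hfz _)
        rw [hx, ← ENNReal.ofReal_sub _ (by nlinarith)]
        exact ENNReal.ofReal_le_ofReal (by linarith)
      refine le_trans ?_ (ENNReal.div_le_div h1 hz)
      rw [← ENNReal.ofReal_div_of_pos (by positivity)]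
      refine ENNReal.ofReal_le_ofReal (le_of_eq ?_)
      field_simp
  unfold localSlope
  rw [if_neg (by simp [hx]), if_neg]
  · refine le_limsup_of_frequently_le' (frequently_nhdsWithin_iff.2 ?_)
    refine Metric.nhds_basis_eball.frequently_iff.2 fun ε hε => ?_
    obtain ⟨z, hz, hfz, hle⟩ := hsmall ε hε
    exact ⟨z, hz, hle, fun hzx => hfz.ne (by rw [hzx])⟩
  · intro hmin
    obtain ⟨ε, hε, hball⟩ := Metric.nhds_basis_eball.eventually_iff.1 hmin
    obtain ⟨z, hz, hfz, -⟩ := hsmall ε hε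
    exact (hball hz).not_gt hfz

end Slope

section LscEnv

variable {X Y : Type*} [NormedAddCommGroup X] [NormedSpace ℝ X] [NormedAddCommGroup Y]
  (F : X → Set Y)

theorem lscEnv_le_infEdist (x : X) (y : Y) : lscEnv F x y ≤ EMetric.infEdist y (F x) :=
  liminf_le_of_frequently_le' (frequently_iff.2 fun hU => ⟨x, mem_of_mem_nhds hU, le_rfl⟩)

theorem lowerSemicontinuous_lscEnv (y : Y) : LowerSemicontinuous fun x => lscEnv F x y := by
  intro x a ha
  obtain ⟨b, hab, hb⟩ := exists_between ha
  filter_upwards [eventually_eventually_nhds.2 (eventually_lt_of_lt_liminf hb)] with z hz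
  exact hab.trans_le (le_liminf_of_le (by isBoundedDefault) (hz.mono fun _ h => h.le))

theorem exists_edist_lt_of_lscEnv_lt {x : X} {y : Y} {b ε : ℝ≥0∞} (h : lscEnv F x y < b)
    (hε : 0 < ε) : ∃ x' y', y' ∈ F x' ∧ edist x' x < ε ∧ edist y y' < b := by
  obtain ⟨x', h1, h2⟩ := ((frequently_lt_of_liminf_lt (by isBoundedDefault) h).and_eventually
    (Metric.eball_mem_nhds x hε)).exists
  obtain ⟨y', hy', hd⟩ := Metric.infEDist_lt_iff.1 h1
  exact ⟨x', y', hy', h2, hd⟩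

theorem mem_of_lscEnv_eq_zero {F : X → Set Y} (hF : IsClosed {p : X × Y | p.2 ∈ F p.1})
    {x : X} {y : Y} (h : lscEnv F x y = 0) : y ∈ F x := by
  refine hF.closure_subset (a := (x, y)) (EMetric.mem_closure_iff.2 fun ε hε => ?_)
  obtain ⟨x', y', hy', hx, hy⟩ :=
    exists_edist_lt_of_lscEnv_lt F (h.trans_lt hε) hε
  exact ⟨(x', y'), hy', by rw [Prod.edist_eq]; exact max_lt (by rwa [edist_comm]) hy⟩

end LscEnv

section Direction

variable {X Y : Type*} [NormedAddCommGroup X] [NormedSpace ℝ X]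
  [NormedAddCommGroup Y] [NormedSpace ℝ Y] {u : X} {v : Y}

theorem coneBall2_mono {δ ε : ℝ} (h : δ ≤ ε) : coneBall2 u v δ ⊆ coneBall2 u v ε := by
  rintro p ⟨l, hl, w, z, hwz, rfl⟩
  exact ⟨l, hl, w, z, hwz.trans_le h, rfl⟩

/-- A relatively small perturbation of a nonzero element of a conic neighborhood stays in a
slightly larger conic neighborhood. -/
theorem mem_coneBall2_of_norm_sub_le {a a' : X} {b b' : Y} {ε κ : ℝ} (hκ : 0 ≤ κ)
    (h : (a, b) ∈ coneBall2 u v ε) (h0 : 0 < ‖a‖ + ‖b‖)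
    (hd : ‖a' - a‖ + ‖b' - b‖ ≤ κ * (‖a‖ + ‖b‖)) :
    (a', b') ∈ coneBall2 u v (ε + κ * (‖u‖ + ‖v‖ + ε)) := by
  obtain ⟨l, hl, w, z, hwz, heq⟩ := h
  obtain ⟨rfl, rfl⟩ := Prod.mk.inj heq
  have hl0 : 0 < l := by
    refine hl.lt_of_ne fun h => ?_
    simp [← h] at h0
  rw [norm_smul, norm_smul, Real.norm_of_nonneg hl] at hd
  refine ⟨l, hl, l⁻¹ • a', l⁻¹ • b', ?_, by simp [smul_smul, hl0.ne']⟩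
  have e1 : ‖l⁻¹ • a' - u‖ ≤ l⁻¹ * ‖a' - l • w‖ + ‖w - u‖ := by
    have : l⁻¹ • a' - u = l⁻¹ • (a' - l • w) + (w - u) := by
      rw [smul_sub, smul_smul, inv_mul_cancel₀ hl0.ne', one_smul]; abel
    rw [this]
    refine (norm_add_le _ _).trans_eq ?_
    rw [norm_smul, Real.norm_of_nonneg (inv_nonneg.2 hl)]
  have e2 : ‖l⁻¹ • b' - v‖ ≤ l⁻¹ * ‖b' - l • z‖ + ‖z - v‖ := by
    have : l⁻¹ • b' - v = l⁻¹ • (b' - l • z) + (z - v) := by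
      rw [smul_sub, smul_smul, inv_mul_cancel₀ hl0.ne', one_smul]; abel
    rw [this]
    refine (norm_add_le _ _).trans_eq ?_
    rw [norm_smul, Real.norm_of_nonneg (inv_nonneg.2 hl)]
  have e3 : l⁻¹ * (‖a' - l • w‖ + ‖b' - l • z‖) ≤ κ * (‖w‖ + ‖z‖) := by
    rw [inv_mul_le_iff₀ hl0]
    linarith
  have e4 : ‖w‖ ≤ ‖w - u‖ + ‖u‖ := norm_le_norm_sub_add w u
  have e5 : ‖z‖ ≤ ‖z - v‖ + ‖v‖ := norm_le_norm_sub_add z v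
  have e6 : κ * (‖w‖ + ‖z‖) ≤ κ * (‖u‖ + ‖v‖ + ε) :=
    mul_le_mul_of_nonneg_left (by linarith) hκ
  linarith

/-- Directional neighborhoods are stable under relatively small perturbations. -/
theorem directional_perturbation {xbar x x' : X} {ybar y y' : Y} {δ δ' κ : ℝ} (hκ : 0 ≤ κ)
    (hκ' : κ ≤ 1 / 2) (hball : (1 + κ) * δ ≤ δ') (hcone : δ + κ * (‖u‖ + ‖v‖ + δ) ≤ δ')
    (h0 : 0 < ‖x - xbar‖ + ‖y - ybar‖) (hN : ‖x - xbar‖ + ‖y - ybar‖ < δ)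
    (hmem : (x - xbar, y - ybar) ∈ coneBall2 u v δ)
    (hd : ‖x' - x‖ + ‖y' - y‖ ≤ κ * (‖x - xbar‖ + ‖y - ybar‖)) :
    ‖x' - xbar‖ + ‖y' - ybar‖ < δ' ∧ (x' - xbar, y' - ybar) ∈ coneBall2 u v δ' ∧
      (‖x - xbar‖ + ‖y - ybar‖) / 2 ≤ ‖x' - xbar‖ + ‖y' - ybar‖ := by
  have ex : ‖x' - xbar‖ ≤ ‖x' - x‖ + ‖x - xbar‖ := norm_sub_le_norm_sub_add_norm_sub _ _ _
  have ey : ‖y' - ybar‖ ≤ ‖y' - y‖ + ‖y - ybar‖ := norm_sub_le_norm_sub_add_norm_sub _ _ _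
  have ex' : ‖x - xbar‖ ≤ ‖x' - x‖ + ‖x' - xbar‖ := by
    rw [norm_sub_rev x' x]; exact norm_sub_le_norm_sub_add_norm_sub _ _ _
  have ey' : ‖y - ybar‖ ≤ ‖y' - y‖ + ‖y' - ybar‖ := by
    rw [norm_sub_rev y' y]; exact norm_sub_le_norm_sub_add_norm_sub _ _ _
  refine ⟨by nlinarith, coneBall2_mono hcone ?_, by nlinarith⟩
  exact mem_coneBall2_of_norm_sub_le hκ hmem h0 (by simpa using hd)

/-- A basis of the filter of directional convergence constrained to the points where
`φ` is positive and `o(‖(x, y) - (xbar, ybar)‖)`. -/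
theorem hasBasis_dirFilter_inf (φ : X × Y → ℝ≥0∞) (xbar : X) (ybar : Y) (u : X) (v : Y) :
    (dirFilter xbar ybar u v ⊓ 𝓟 {p : X × Y | 0 < φ p} ⊓
      ⨅ (η : ℝ) (_ : 0 < η),
        𝓟 {p : X × Y | φ p < ENNReal.ofReal (η * (‖p.1 - xbar‖ + ‖p.2 - ybar‖))}).HasBasis
      (fun δ : ℝ => 0 < δ) fun δ => {p : X × Y | ‖p.1 - xbar‖ + ‖p.2 - ybar‖ < δ ∧
        (p.1 - xbar, p.2 - ybar) ∈ coneBall2 u v δ ∧ 0 < φ p ∧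
        φ p < ENNReal.ofReal (δ * (‖p.1 - xbar‖ + ‖p.2 - ybar‖))} := by
  have hcone : (⨅ (δ : ℝ) (_ : 0 < δ),
      𝓟 {p : X × Y | (p.1 - xbar, p.2 - ybar) ∈ coneBall2 u v δ}).HasBasis (fun δ : ℝ => 0 < δ)
      fun δ => {p : X × Y | (p.1 - xbar, p.2 - ybar) ∈ coneBall2 u v δ} :=
    hasBasis_biInf_principal' (fun i hi j hj => ⟨min i j, lt_min hi hj,
      fun _ hp => coneBall2_mono (min_le_left _ _) hp,
      fun _ hp => coneBall2_mono (min_le_right _ _) hp⟩) ⟨1, one_pos⟩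
  have hsmall : (⨅ (η : ℝ) (_ : 0 < η),
      𝓟 {p : X × Y | φ p < ENNReal.ofReal (η * (‖p.1 - xbar‖ + ‖p.2 - ybar‖))}).HasBasis
      (fun η : ℝ => 0 < η)
      fun η => {p : X × Y | φ p < ENNReal.ofReal (η * (‖p.1 - xbar‖ + ‖p.2 - ybar‖))} :=
    hasBasis_biInf_principal' (fun i hi j hj => ⟨min i j, lt_min hi hj,
      fun p hp => lt_of_lt_of_le hp (ENNReal.ofReal_le_ofReal (by gcongr; exact min_le_left _ _)),
      fun p hp => lt_of_lt_of_le hp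
        (ENNReal.ofReal_le_ofReal (by gcongr; exact min_le_right _ _))⟩) ⟨1, one_pos⟩
  refine ((((Metric.nhds_basis_ball (x := (xbar, ybar))).inf hcone).inf_principal _).inf
    hsmall).to_hasBasis ?_ ?_
  · rintro ⟨⟨r, δ⟩, η⟩ ⟨⟨hr, hδ⟩, hη⟩
    refine ⟨min r (min δ η), lt_min hr (lt_min hδ hη), ?_⟩
    rintro p ⟨h1, h2, h3, h4⟩
    refine ⟨⟨⟨?_, coneBall2_mono ((min_le_right _ _).trans (min_le_left _ _)) h2⟩, h3⟩,
      h4.trans_le (ENNReal.ofReal_le_ofReal ?_)⟩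
    · have := h1.trans_le (min_le_left _ _)
      rw [Metric.mem_ball, Prod.dist_eq, dist_eq_norm, dist_eq_norm]
      exact max_lt (by linarith [norm_nonneg (p.2 - ybar)]) (by linarith [norm_nonneg (p.1 - xbar)])
    · gcongr
      exact (min_le_right _ _).trans (min_le_right _ _)
  · intro δ hδ
    refine ⟨⟨⟨δ / 2, δ⟩, δ⟩, ⟨⟨by simpa using hδ, hδ⟩, hδ⟩, ?_⟩
    rintro p ⟨⟨⟨h1, h2⟩, h3⟩, h4⟩
    refine ⟨?_, h2, h3, h4⟩
    rw [Metric.mem_ball, Prod.dist_eq, dist_eq_norm, dist_eq_norm] at h1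
    linarith [(le_max_left _ _).trans_lt h1, (le_max_right _ _).trans_lt h1]

end Direction

section Regularity

variable {X Y : Type*} [NormedAddCommGroup X] [NormedSpace ℝ X]
  [NormedAddCommGroup Y] [NormedSpace ℝ Y] {F : X → Set Y} {xbar : X} {ybar : Y} {u : X} {v : Y}

/-- A uniform lower bound of the slopes near `(xbar, ybar)` in direction `(u, v)` yields
directional metric regularity. -/
theorem exists_infEdist_le_of_lt_localSlope [CompleteSpace X]
    (hF : IsClosed {p : X × Y | p.2 ∈ F p.1}) (hxy : ybar ∈ F xbar) {c δ₀ : ℝ} (hc : 0 < c)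
    (hδ₀ : 0 < δ₀)
    (h : ∀ x y, ‖x - xbar‖ + ‖y - ybar‖ < δ₀ → (x - xbar, y - ybar) ∈ coneBall2 u v δ₀ →
      0 < lscEnv F x y → lscEnv F x y < ENNReal.ofReal (δ₀ * (‖x - xbar‖ + ‖y - ybar‖)) →
      ENNReal.ofReal c < localSlope (fun x => lscEnv F x y) x) :
    ∃ δ > (0:ℝ), ∀ x : X, ∀ y : Y,
      ‖x - xbar‖ + ‖y - ybar‖ < δ → (x - xbar, y - ybar) ∈ coneBall2 u v δ →
      EMetric.infEdist y (F x) ≤ ENNReal.ofReal (δ * (‖x - xbar‖ + ‖y - ybar‖)) →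
      EMetric.infEdist x {x' : X | y ∈ F x'} ≤
        ENNReal.ofReal c⁻¹ * EMetric.infEdist y (F x) := by
  obtain ⟨δ, hδ, hκ, hball, hcone, hδδ₀⟩ : ∃ δ : ℝ, 0 < δ ∧ c⁻¹ * δ ≤ 1 / 2 ∧
      (1 + c⁻¹ * δ) * δ ≤ δ₀ ∧ δ + c⁻¹ * δ * (‖u‖ + ‖v‖ + δ) ≤ δ₀ ∧ 2 * δ < δ₀ := by
    have ev : ∀ (g : ℝ → ℝ) (b : ℝ), Continuous g → g 0 < b → ∀ᶠ δ in 𝓝[>] (0 : ℝ), g δ < b :=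
      fun g b hg hb => (hg.continuousAt.eventually_lt_const hb).filter_mono nhdsWithin_le_nhds
    obtain ⟨δ, h1, h2, h3, h4, h5⟩ := ((ev (fun δ => c⁻¹ * δ) (1 / 2) (by fun_prop) (by simp)).and
      ((ev (fun δ => (1 + c⁻¹ * δ) * δ) δ₀ (by fun_prop) (by simpa)).and
      ((ev (fun δ => δ + c⁻¹ * δ * (‖u‖ + ‖v‖ + δ)) δ₀ (by fun_prop) (by simpa)).and
      ((ev (fun δ => 2 * δ) δ₀ (by fun_prop) (by simpa)).and self_mem_nhdsWithin)))).exists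
    exact ⟨δ, h5, h1.le, h2.le, h3.le, h4⟩
  refine ⟨δ, hδ, fun x y hN hmem hle => ?_⟩
  have infEdist_zero : ∀ {x y}, y ∈ F x → EMetric.infEdist x {x' : X | y ∈ F x'} = 0 :=
    fun {x y} hy => Metric.infEDist_zero_of_mem (s := {x' : X | y ∈ F x'}) hy
  rcases (add_nonneg (norm_nonneg (x - xbar)) (norm_nonneg (y - ybar))).eq_or_lt with h0 | h0
  · have hx : x = xbar := sub_eq_zero.1 (norm_eq_zero.1 (by
      linarith [norm_nonneg (x - xbar), norm_nonneg (y - ybar)]))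
    have hy : y = ybar := sub_eq_zero.1 (norm_eq_zero.1 (by
      linarith [norm_nonneg (x - xbar), norm_nonneg (y - ybar)]))
    subst hx hy
    rw [infEdist_zero hxy]
    exact zero_le
  set N := ‖x - xbar‖ + ‖y - ybar‖ with hNdef
  have hfx : lscEnv F x y ≤ ENNReal.ofReal (δ * N) := (lscEnv_le_infEdist F x y).trans hle
  have hcE : ENNReal.ofReal c ≠ 0 := (ENNReal.ofReal_pos.2 hc).ne'
  obtain ⟨z, hz, hzmin⟩ :=
    (lowerSemicontinuous_lscEnv F y).exists_forall_lt_add_mul_edist hcE ENNReal.ofReal_ne_top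
      (ne_top_of_le_ne_top ENNReal.ofReal_ne_top hfx)
  have hfz : lscEnv F z y ≤ ENNReal.ofReal (δ * N) := (le_self_add.trans hz).trans hfx
  have hdist : edist z x ≤ ENNReal.ofReal c⁻¹ * lscEnv F x y := by
    rw [ENNReal.ofReal_inv_of_pos hc, mul_comm, ← div_eq_mul_inv,
      ENNReal.le_div_iff_mul_le (Or.inl hcE) (Or.inl ENNReal.ofReal_ne_top), mul_comm]
    exact le_add_self.trans hz
  have hdist' : ‖z - x‖ ≤ c⁻¹ * δ * N := by
    have h1 : edist z x ≤ ENNReal.ofReal (c⁻¹ * δ * N) := by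
      refine hdist.trans ?_
      rw [mul_assoc, ENNReal.ofReal_mul (by positivity)]
      gcongr
    rw [edist_dist, ENNReal.ofReal_le_ofReal_iff (by positivity), dist_eq_norm] at h1
    exact h1
  obtain ⟨hzN, hzmem, hzhalf⟩ := directional_perturbation (x' := z) (y' := y) (by positivity)
    hκ hball hcone h0 hN hmem (by simpa using hdist')
  have hfz0 : lscEnv F z y = 0 := by
    by_contra hne
    refine (h z y hzN hzmem (pos_iff_ne_zero.2 hne) (hfz.trans_lt ?_)).not_ge ?_
    · rw [ENNReal.ofReal_lt_ofReal_iff (by nlinarith)]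
      nlinarith
    · refine localSlope_le_of_forall_le_add (ne_top_of_le_ne_top ENNReal.ofReal_ne_top hfz)
        fun w => ?_
      rcases eq_or_ne w z with rfl | hw
      · exact le_self_add
      · exact (hzmin w hw).le
  calc EMetric.infEdist x {x' : X | y ∈ F x'} ≤ edist x z :=
        Metric.infEDist_le_edist_of_mem (s := {x' : X | y ∈ F x'}) (mem_of_lscEnv_eq_zero hF hfz0)
    _ = edist z x := edist_comm _ _
    _ ≤ ENNReal.ofReal c⁻¹ * lscEnv F x y := hdist
    _ ≤ ENNReal.ofReal c⁻¹ * EMetric.infEdist y (F x) := by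
        gcongr
        exact lscEnv_le_infEdist F x y

/-- Directional metric regularity yields a uniform lower bound of the slopes near
`(xbar, ybar)` in direction `(u, v)`. -/
theorem exists_le_localSlope_of_infEdist_le {τ δ₁ : ℝ} (hτ : 0 < τ) (hδ₁ : 0 < δ₁)
    (h : ∀ x : X, ∀ y : Y,
      ‖x - xbar‖ + ‖y - ybar‖ < δ₁ → (x - xbar, y - ybar) ∈ coneBall2 u v δ₁ →
      EMetric.infEdist y (F x) ≤ ENNReal.ofReal (δ₁ * (‖x - xbar‖ + ‖y - ybar‖)) →
      EMetric.infEdist x {x' : X | y ∈ F x'} ≤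
        ENNReal.ofReal τ * EMetric.infEdist y (F x)) :
    ∃ δ > (0:ℝ), ∀ x y, ‖x - xbar‖ + ‖y - ybar‖ < δ →
      (x - xbar, y - ybar) ∈ coneBall2 u v δ → 0 < lscEnv F x y →
      lscEnv F x y < ENNReal.ofReal (δ * (‖x - xbar‖ + ‖y - ybar‖)) →
      ENNReal.ofReal (1 / (2 * (2 * τ + 2))) ≤ localSlope (fun x => lscEnv F x y) x := by
  obtain ⟨δ, hδ, hκ, hball, hcone, hδδ₁⟩ : ∃ δ : ℝ, 0 < δ ∧ 3 * δ ≤ 1 / 2 ∧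
      (1 + 3 * δ) * δ ≤ δ₁ ∧ δ + 3 * δ * (‖u‖ + ‖v‖ + δ) ≤ δ₁ ∧ 4 * δ ≤ δ₁ := by
    have ev : ∀ (g : ℝ → ℝ) (b : ℝ), Continuous g → g 0 < b → ∀ᶠ δ in 𝓝[>] (0 : ℝ), g δ < b :=
      fun g b hg hb => (hg.continuousAt.eventually_lt_const hb).filter_mono nhdsWithin_le_nhds
    obtain ⟨δ, h1, h2, h3, h4, h5⟩ := ((ev (fun δ => 3 * δ) (1 / 2) (by fun_prop) (by simp)).and
      ((ev (fun δ => (1 + 3 * δ) * δ) δ₁ (by fun_prop) (by simpa)).and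
      ((ev (fun δ => δ + 3 * δ * (‖u‖ + ‖v‖ + δ)) δ₁ (by fun_prop) (by simpa)).and
      ((ev (fun δ => 4 * δ) δ₁ (by fun_prop) (by simpa)).and self_mem_nhdsWithin)))).exists
    exact ⟨δ, h5, h1.le, h2.le, h3.le, h4.le⟩
  refine ⟨δ, hδ, fun x y hN hmem hpos hlt => ?_⟩
  set N := ‖x - xbar‖ + ‖y - ybar‖ with hNdef
  set a := (lscEnv F x y).toReal with hadef
  have hfa : lscEnv F x y = ENNReal.ofReal a := (ENNReal.ofReal_toReal hlt.ne_top).symm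
  have ha : 0 < a := ENNReal.toReal_pos hpos.ne' hlt.ne_top
  have haN : a < δ * N := by
    rw [hfa] at hlt
    exact (ENNReal.ofReal_lt_ofReal_iff_of_nonneg ha.le).1 hlt
  have hN0 : 0 < N := pos_of_mul_pos_right (ha.trans haN) hδ.le
  refine le_localSlope_of_forall_exists ha (by positivity) hfa fun t ht0 ht1 => ?_
  have hta : 0 < t * a := mul_pos ht0 ha
  have hta' : t * a < a := by nlinarith
  obtain ⟨x', y', hy', hx', hyy'⟩ := exists_edist_lt_of_lscEnv_lt F (x := x) (y := y)
    (b := ENNReal.ofReal ((1 + t / 2) * a)) (ε := ENNReal.ofReal (t * a))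
    (by rw [hfa, ENNReal.ofReal_lt_ofReal_iff (by positivity)]; linarith)
    (ENNReal.ofReal_pos.2 hta)
  rw [edist_dist, ENNReal.ofReal_lt_ofReal_iff (by positivity), dist_eq_norm] at hx' hyy'
  set q : Y := y + (1 - t) • (y' - y) with hq
  have hqy : ‖q - y‖ = (1 - t) * ‖y - y'‖ := by
    rw [hq, add_sub_cancel_left, norm_smul, Real.norm_of_nonneg (by linarith), norm_sub_rev]
  have hqy' : ‖q - y'‖ = t * ‖y - y'‖ := by
    have : q - y' = t • (y - y') := by rw [hq]; module
    rw [this, norm_smul, Real.norm_of_nonneg ht0.le]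
  have hyy2 : ‖y - y'‖ ≤ 2 * a := by nlinarith
  obtain ⟨hqN, hqmem, hqhalf⟩ := directional_perturbation (x' := x') (y' := q) (by positivity)
    hκ hball hcone hN0 hN hmem (by rw [hqy]; nlinarith [norm_nonneg (y - y')])
  have hqF : EMetric.infEdist q (F x') ≤ ENNReal.ofReal (2 * (t * a)) := by
    refine (Metric.infEDist_le_edist_of_mem hy').trans ?_
    rw [edist_dist, dist_eq_norm, hqy']
    exact ENNReal.ofReal_le_ofReal (by nlinarith)
  have hreg := h x' q hqN hqmem (hqF.trans (ENNReal.ofReal_le_ofReal (by nlinarith)))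
  have hreg' : Metric.infEDist x' {x' : X | q ∈ F x'} <
      ENNReal.ofReal ((2 * τ + 1) * (t * a)) := by
    refine (hreg.trans (mul_le_mul_right hqF _)).trans_lt ?_
    rw [← ENNReal.ofReal_mul hτ.le, ENNReal.ofReal_lt_ofReal_iff (by positivity)]
    linarith
  obtain ⟨z, hz, hxz⟩ := Metric.infEDist_lt_iff.1 hreg'
  refine ⟨z, ?_, ?_⟩
  · calc edist x z ≤ edist x' x + edist x' z := edist_triangle_left _ _ _
      _ ≤ ENNReal.ofReal (t * a) + ENNReal.ofReal ((2 * τ + 1) * (t * a)) := by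
          refine add_le_add ?_ hxz.le
          rw [edist_dist, dist_eq_norm]
          exact ENNReal.ofReal_le_ofReal hx'.le
      _ = ENNReal.ofReal ((2 * τ + 2) * (t * a)) := by
          rw [← ENNReal.ofReal_add (by positivity) (by positivity)]
          ring_nf
  · refine (lscEnv_le_infEdist F z y).trans
      ((Metric.infEDist_le_edist_of_mem (show q ∈ F z from hz)).trans ?_)
    rw [edist_dist, dist_comm, dist_eq_norm, hqy]
    refine ENNReal.ofReal_le_ofReal ?_
    nlinarith [mul_le_mul_of_nonneg_left hyy'.le (sub_nonneg.2 ht1.le), mul_pos ht0 hta]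

end Regularity

/-- Theorem 3 of the paper, the Lipschitz case `γ = 1`: the liminf of the
local slopes `|∇ φ(·,y)|(x)`, taken as `(x,y) →_{(u,v)} (xbar,ybar)` with `φ(x,y) > 0` and
`φ(x,y)/‖(x,y) − (xbar,ybar)‖ → 0`, is positive iff there exist `τ, δ > 0` with
`d(x, F⁻¹(y)) ≤ τ d(y, F(x))` for all `(x,y) ∈ B((xbar,ybar),δ)` with
`(x,y) ∈ (xbar,ybar) + cone B((u,v),δ)` and `d(y,F(x)) ≤ δ‖(x,y) − (xbar,ybar)‖`;
i.e. `F` is directionally metrically regular at `(xbar,ybar)` in direction `(u,v)`. -/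
theorem liminf_localSlope_pos_iff_dirMetricRegular
    {X Y : Type*} [NormedAddCommGroup X] [NormedSpace ℝ X] [CompleteSpace X]
    [NormedAddCommGroup Y] [NormedSpace ℝ Y]
    (F : X → Set Y) (hF : IsClosed {p : X × Y | p.2 ∈ F p.1})
    (xbar : X) (ybar : Y) (hxy : ybar ∈ F xbar) (u : X) (v : Y) :
    (0 < Filter.liminf
        (fun p : X × Y => localSlope (fun x : X => lscEnv F x p.2) p.1)
        (dirFilter xbar ybar u v ⊓ 𝓟 {p : X × Y | 0 < lscEnv F p.1 p.2} ⊓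
          ⨅ (η : ℝ) (_ : 0 < η),
            𝓟 {p : X × Y |
              lscEnv F p.1 p.2 < ENNReal.ofReal (η * (‖p.1 - xbar‖ + ‖p.2 - ybar‖))})) ↔
      ∃ τ > (0:ℝ), ∃ δ > (0:ℝ), ∀ x : X, ∀ y : Y,
        ‖x - xbar‖ + ‖y - ybar‖ < δ →
        (x - xbar, y - ybar) ∈ coneBall2 u v δ →
        EMetric.infEdist y (F x) ≤ ENNReal.ofReal (δ * (‖x - xbar‖ + ‖y - ybar‖)) →
        EMetric.infEdist x {x' : X | y ∈ F x'} ≤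
          ENNReal.ofReal τ * EMetric.infEdist y (F x) := by
  have hbasis := hasBasis_dirFilter_inf (fun p : X × Y => lscEnv F p.1 p.2) xbar ybar u v
  constructor
  · intro hpos
    obtain ⟨c, hc0, hc⟩ := ENNReal.lt_iff_exists_nnreal_btwn.1 hpos
    have hc0' : (0 : ℝ) < c := by exact_mod_cast hc0
    obtain ⟨δ₀, hδ₀, h⟩ := hbasis.eventually_iff.1 (eventually_lt_of_lt_liminf hc)
    obtain ⟨δ, hδ, hreg⟩ := exists_infEdist_le_of_lt_localSlope hF hxy hc0' hδ₀
      fun x y h1 h2 h3 h4 => by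
        rw [ENNReal.ofReal_coe_nnreal]
        exact h (x := (x, y)) ⟨h1, h2, h3, h4⟩
    exact ⟨(c : ℝ)⁻¹, inv_pos.2 hc0', δ, hδ, hreg⟩
  · rintro ⟨τ, hτ, δ₁, hδ₁, h⟩
    obtain ⟨δ, hδ, hslope⟩ := exists_le_localSlope_of_infEdist_le hτ hδ₁ h
    refine lt_of_lt_of_le (ENNReal.ofReal_pos.2 (show 0 < 1 / (2 * (2 * τ + 2)) by positivity))
      (le_liminf_of_le (by isBoundedDefault) (hbasis.eventually_iff.2 ⟨δ, hδ, ?_⟩))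
    rintro ⟨x, y⟩ ⟨h1, h2, h3, h4⟩
    exact hslope x y h1 h2 h3 h4

end
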